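/- arXiv:0901.0207 — 3 statements merged into one kernel-verified Lean document; each statement's English description precedes it below -/
import Mathlib

section
/- Suppose Π(A₂) = 0 and Π(A₃) = 0. Then L*(Π) = {u ∈ ℝ : θ₁ ≤ u and u ≤ θ₄} (the inequalities being taken in the extended reals); in particular 0 ∈ L*(Π). (Measure-theoretic form of case (c) of Proposition 'endpoints of L star' (5).) -/
open MeasureTheory Set Filter

noncomputable section

/-- The region below the curve `y = u (e^{-x} - 1)`: jumps causing a negative jump of the GOU. -/
def Cneg (u : ℝ) : Set (ℝ × ℝ) := {p | p.2 - u * (Real.exp (-p.1) - 1) < 0}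

/-- The region above the curve `y = u (e^{-x} - 1)`: jumps causing a positive jump of the GOU. -/
def Cpos (u : ℝ) : Set (ℝ × ℝ) := {p | 0 < p.2 - u * (Real.exp (-p.1) - 1)}

/-- Set of starting values at which the GOU process has no negative jumps. -/
def Lstar (mu : Measure (ℝ × ℝ)) : Set ℝ := {u | mu (Cneg u) = 0}

/-- Set of starting values at which the GOU process has no positive jumps. -/
def Ustar (mu : Measure (ℝ × ℝ)) : Set ℝ := {u | mu (Cpos u) = 0}

def A1 : Set (ℝ × ℝ) := {p | 0 ≤ p.1 ∧ 0 ≤ p.2}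
def A2 : Set (ℝ × ℝ) := {p | 0 ≤ p.1 ∧ p.2 ≤ 0}
def A3 : Set (ℝ × ℝ) := {p | p.1 ≤ 0 ∧ p.2 ≤ 0}
def A4 : Set (ℝ × ℝ) := {p | p.1 ≤ 0 ∧ 0 ≤ p.2}

noncomputable def theta1 (mu : Measure (ℝ × ℝ)) : EReal :=
  if 0 < mu (A1 \ A4) then
    sSup ((fun v : ℝ => (v : EReal)) '' {v | v ≤ 0 ∧ 0 < mu (A1 ∩ Cneg v)}) else ⊥

noncomputable def theta2 (mu : Measure (ℝ × ℝ)) : EReal :=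
  if 0 < mu (A2 \ A1) then
    sSup ((fun v : ℝ => (v : EReal)) '' {v | 0 ≤ v ∧ 0 < mu (A2 ∩ Cneg v)}) else 0

noncomputable def theta3 (mu : Measure (ℝ × ℝ)) : EReal :=
  if 0 < mu (A3 \ A4) then
    sInf ((fun v : ℝ => (v : EReal)) '' {v | v ≤ 0 ∧ 0 < mu (A3 ∩ Cneg v)}) else 0

noncomputable def theta4 (mu : Measure (ℝ × ℝ)) : EReal :=
  if 0 < mu (A4 \ A1) then
    sInf ((fun v : ℝ => (v : EReal)) '' {v | 0 ≤ v ∧ 0 < mu (A4 ∩ Cneg v)}) else ⊤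

noncomputable def theta1' (mu : Measure (ℝ × ℝ)) : EReal :=
  if 0 < mu (A1 \ A2) then
    sInf ((fun v : ℝ => (v : EReal)) '' {v | v ≤ 0 ∧ 0 < mu (A1 ∩ Cpos v)}) else 0

noncomputable def theta2' (mu : Measure (ℝ × ℝ)) : EReal :=
  if 0 < mu (A2 \ A3) then
    sInf ((fun v : ℝ => (v : EReal)) '' {v | 0 ≤ v ∧ 0 < mu (A2 ∩ Cpos v)}) else ⊤

noncomputable def theta3' (mu : Measure (ℝ × ℝ)) : EReal :=
  if 0 < mu (A3 \ A2) then
    sSup ((fun v : ℝ => (v : EReal)) '' {v | v ≤ 0 ∧ 0 < mu (A3 ∩ Cpos v)}) else ⊥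

noncomputable def theta4' (mu : Measure (ℝ × ℝ)) : EReal :=
  if 0 < mu (A4 \ A3) then
    sSup ((fun v : ℝ => (v : EReal)) '' {v | 0 ≤ v ∧ 0 < mu (A4 ∩ Cpos v)}) else 0

lemma measure_inter_Cneg_eq_zero_of_tendsto {mu : Measure (ℝ × ℝ)} {A : Set (ℝ × ℝ)} {u : ℝ}
    {w : ℕ → ℝ} (hw : Tendsto w atTop (nhds u)) (h : ∀ n, mu (A ∩ Cneg (w n)) = 0) :
    mu (A ∩ Cneg u) = 0 := by
  refine measure_mono_null ?_ (measure_iUnion_null h)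
  rintro p ⟨hpA, hp⟩
  have hlim : Tendsto (fun n => p.2 - w n * (Real.exp (-p.1) - 1)) atTop
      (nhds (p.2 - u * (Real.exp (-p.1) - 1))) := (hw.mul_const _).const_sub _
  obtain ⟨n, hn⟩ := (hlim.eventually_lt_const hp).exists
  exact mem_iUnion.2 ⟨n, hpA, hn⟩

lemma exp_neg_sub_one_nonpos {x : ℝ} (hx : 0 ≤ x) : Real.exp (-x) - 1 ≤ 0 := by
  simpa using hx

lemma exp_neg_sub_one_nonneg {x : ℝ} (hx : x ≤ 0) : 0 ≤ Real.exp (-x) - 1 := by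
  simpa using hx

lemma A1_inter_Cneg_antitone : Antitone fun u => A1 ∩ Cneg u := by
  rintro u v huv p ⟨hpA, hp⟩
  refine ⟨hpA, ?_⟩
  rw [Cneg, mem_ofPred_eq] at hp ⊢
  have := mul_le_mul_of_nonpos_right huv (exp_neg_sub_one_nonpos hpA.1)
  linarith

lemma A4_inter_Cneg_monotone : Monotone fun u => A4 ∩ Cneg u := by
  rintro u v huv p ⟨hpA, hp⟩
  refine ⟨hpA, ?_⟩
  rw [Cneg, mem_ofPred_eq] at hp ⊢
  have := mul_le_mul_of_nonneg_right huv (exp_neg_sub_one_nonneg hpA.1)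
  linarith

lemma fst_ne_zero_of_mem_Cneg {u : ℝ} {p : ℝ × ℝ} (hp : p ∈ Cneg u) (hy : 0 ≤ p.2) :
    p.1 ≠ 0 := by
  intro hx
  have : p.2 - u * (Real.exp (-p.1) - 1) < 0 := hp
  simp [hx] at this
  linarith

lemma A1_inter_Cneg_subset (u : ℝ) : A1 ∩ Cneg u ⊆ A1 \ A4 := fun _ hp =>
  ⟨hp.1, fun h => fst_ne_zero_of_mem_Cneg hp.2 hp.1.2 (le_antisymm h.1 hp.1.1)⟩

lemma A4_inter_Cneg_subset (u : ℝ) : A4 ∩ Cneg u ⊆ A4 \ A1 := fun _ hp =>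
  ⟨hp.1, fun h => fst_ne_zero_of_mem_Cneg hp.2 hp.1.2 (le_antisymm hp.1.1 h.1)⟩

lemma theta1_nonpos (mu : Measure (ℝ × ℝ)) : theta1 mu ≤ 0 := by
  unfold theta1
  split_ifs
  · refine sSup_le ?_
    rintro _ ⟨v, hv, rfl⟩
    exact EReal.coe_nonpos.2 hv.1
  · exact bot_le

lemma theta4_nonneg (mu : Measure (ℝ × ℝ)) : 0 ≤ theta4 mu := by
  unfold theta4
  split_ifs
  · refine le_sInf ?_
    rintro _ ⟨v, hv, rfl⟩
    exact EReal.coe_nonneg.2 hv.1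
  · exact le_top

lemma theta1_le_iff {mu : Measure (ℝ × ℝ)} {u : ℝ} (hu : u < 0) :
    theta1 mu ≤ u ↔ mu (A1 ∩ Cneg u) = 0 := by
  unfold theta1
  split_ifs with h
  · simp only [sSup_le_iff, forall_mem_image, EReal.coe_le_coe_iff]
    constructor
    · intro H
      obtain ⟨w, -, hw, hlim⟩ := exists_seq_strictAnti_tendsto' hu
      refine measure_inter_Cneg_eq_zero_of_tendsto hlim fun n => ?_
      by_contra hn
      exact (H ⟨(hw n).2.le, pos_iff_ne_zero.2 hn⟩).not_gt (hw n).1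
    · intro H v hv
      by_contra! huv
      exact hv.2.ne' (measure_mono_null (A1_inter_Cneg_antitone huv.le) H)
  · exact iff_of_true bot_le
      (measure_mono_null (A1_inter_Cneg_subset u) (by simpa using h))

lemma le_theta4_iff {mu : Measure (ℝ × ℝ)} {u : ℝ} (hu : 0 < u) :
    u ≤ theta4 mu ↔ mu (A4 ∩ Cneg u) = 0 := by
  unfold theta4
  split_ifs with h
  · simp only [le_sInf_iff, forall_mem_image, EReal.coe_le_coe_iff]
    constructor
    · intro H
      obtain ⟨w, -, hw, hlim⟩ := exists_seq_strictMono_tendsto' hu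
      refine measure_inter_Cneg_eq_zero_of_tendsto hlim fun n => ?_
      by_contra hn
      exact (H ⟨(hw n).1.le, pos_iff_ne_zero.2 hn⟩).not_gt (hw n).2
    · intro H v hv
      by_contra! huv
      exact hv.2.ne' (measure_mono_null (A4_inter_Cneg_monotone huv.le) H)
  · exact iff_of_true le_top
      (measure_mono_null (A4_inter_Cneg_subset u) (by simpa using h))

lemma measure_Cneg_eq_zero_iff_of_nonpos {mu : Measure (ℝ × ℝ)} (h2 : mu A2 = 0)
    (h3 : mu A3 = 0) {u : ℝ} (hu : u ≤ 0) : mu (Cneg u) = 0 ↔ mu (A1 ∩ Cneg u) = 0 := by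
  refine ⟨measure_mono_null inter_subset_right, fun h1 => ?_⟩
  refine measure_mono_null ?_ (measure_union_null h1 (measure_union_null h2 h3))
  intro p hp
  rcases le_total 0 p.1 with hx | hx
  · rcases le_total 0 p.2 with hy | hy
    · exact .inl ⟨⟨hx, hy⟩, hp⟩
    · exact .inr (.inl ⟨hx, hy⟩)
  · have hlt : p.2 - u * (Real.exp (-p.1) - 1) < 0 := hp
    have := mul_nonpos_of_nonpos_of_nonneg hu (exp_neg_sub_one_nonneg hx)
    exact .inr (.inr ⟨hx, by linarith⟩)

lemma measure_Cneg_eq_zero_iff_of_nonneg {mu : Measure (ℝ × ℝ)} (h2 : mu A2 = 0)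
    (h3 : mu A3 = 0) {u : ℝ} (hu : 0 ≤ u) : mu (Cneg u) = 0 ↔ mu (A4 ∩ Cneg u) = 0 := by
  refine ⟨measure_mono_null inter_subset_right, fun h4 => ?_⟩
  refine measure_mono_null ?_ (measure_union_null h4 (measure_union_null h2 h3))
  intro p hp
  rcases le_total p.1 0 with hx | hx
  · rcases le_total 0 p.2 with hy | hy
    · exact .inl ⟨⟨hx, hy⟩, hp⟩
    · exact .inr (.inr ⟨hx, hy⟩)
  · have hlt : p.2 - u * (Real.exp (-p.1) - 1) < 0 := hp
    have := mul_nonpos_of_nonneg_of_nonpos hu (exp_neg_sub_one_nonpos hx)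
    exact .inr (.inl ⟨hx, by linarith⟩)

lemma zero_mem_Lstar {mu : Measure (ℝ × ℝ)} (h2 : mu A2 = 0) (h3 : mu A3 = 0) :
    (0 : ℝ) ∈ Lstar mu := by
  refine measure_mono_null ?_ (measure_union_null h2 h3)
  intro p hp
  have hy : p.2 < 0 := by simpa [Cneg] using hp
  exact (le_total 0 p.1).imp (⟨·, hy.le⟩) (⟨·, hy.le⟩)

theorem lstar_eq_interval_case_c (mu : Measure (ℝ × ℝ))
    (h2 : mu A2 = 0) (h3 : mu A3 = 0) :
    Lstar mu = {u : ℝ | theta1 mu ≤ (u : EReal) ∧ (u : EReal) ≤ theta4 mu} ∧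
      (0 : ℝ) ∈ Lstar mu := by
  refine ⟨Set.ext fun u => ?_, zero_mem_Lstar h2 h3⟩
  rw [mem_ofPred_eq]
  rcases lt_trichotomy u 0 with hu | rfl | hu
  · have hu4 : (u : EReal) ≤ theta4 mu :=
      le_trans (by exact_mod_cast hu.le) (theta4_nonneg mu)
    rw [theta1_le_iff hu, and_iff_left hu4]
    exact measure_Cneg_eq_zero_iff_of_nonpos h2 h3 hu.le
  · exact iff_of_true (zero_mem_Lstar h2 h3) ⟨theta1_nonpos mu, theta4_nonneg mu⟩
  · have hu1 : theta1 mu ≤ u := (theta1_nonpos mu).trans (by exact_mod_cast hu.le)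
    rw [le_theta4_iff hu, and_iff_right hu1]
    exact measure_Cneg_eq_zero_iff_of_nonneg h2 h3 hu.le

end
end

section
/- If L*(Π) = (−∞, a] for some a ∈ ℝ, then either U*(Π) = ∅ or U*(Π) = [b, ∞) for some real number b with a ≤ b. (Statement (4) of the proposition on the possible combinations of L* and U*.) -/
open MeasureTheory Set Filter

noncomputable section

lemma mem_Lstar_iff_ae {mu : Measure (ℝ × ℝ)} {u : ℝ} :
    u ∈ Lstar mu ↔ ∀ᵐ p ∂mu, u * (Real.exp (-p.1) - 1) ≤ p.2 := by
  simp only [Lstar, mem_ofPred_eq, measure_eq_zero_iff_ae_notMem, Cneg, not_lt, sub_nonneg]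

lemma mem_Ustar_iff_ae {mu : Measure (ℝ × ℝ)} {u : ℝ} :
    u ∈ Ustar mu ↔ ∀ᵐ p ∂mu, p.2 ≤ u * (Real.exp (-p.1) - 1) := by
  simp only [Ustar, mem_ofPred_eq, measure_eq_zero_iff_ae_notMem, Cpos, not_lt, sub_nonpos]

lemma ae_exp_neg_sub_one_nonneg_of_Iic_subset_Lstar {mu : Measure (ℝ × ℝ)} {a : ℝ}
    (hL : Set.Iic a ⊆ Lstar mu) : ∀ᵐ p ∂mu, 0 ≤ Real.exp (-p.1) - 1 := by
  have hmem : ∀ n : ℕ, ∀ᵐ p ∂mu, (a - n) * (Real.exp (-p.1) - 1) ≤ p.2 := fun n ↦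
    mem_Lstar_iff_ae.1 (hL (sub_le_self a n.cast_nonneg))
  filter_upwards [ae_all_iff.2 hmem] with p hp
  by_contra! hneg
  obtain ⟨n, hn⟩ := Archimedean.arch (p.2 - a * (Real.exp (-p.1) - 1) + 1) (neg_pos.2 hneg)
  have := hp n
  rw [nsmul_eq_mul] at hn
  linarith

lemma mem_Ustar_of_le {mu : Measure (ℝ × ℝ)} (hc : ∀ᵐ p ∂mu, 0 ≤ Real.exp (-p.1) - 1)
    {u v : ℝ} (hu : u ∈ Ustar mu) (huv : u ≤ v) : v ∈ Ustar mu := by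
  rw [mem_Ustar_iff_ae] at hu ⊢
  filter_upwards [hc, hu] with p hp hup
  exact hup.trans (mul_le_mul_of_nonneg_right huv hp)

lemma isClosed_Ustar (mu : Measure (ℝ × ℝ)) : IsClosed (Ustar mu) := by
  refine IsSeqClosed.isClosed fun s u hs hsu ↦ mem_Ustar_iff_ae.2 ?_
  filter_upwards [ae_all_iff.2 fun n ↦ mem_Ustar_iff_ae.1 (hs n)] with p hp
  exact ge_of_tendsto' (hsu.mul_const _) hp

lemma Lstar_eq_univ_of_lt {mu : Measure (ℝ × ℝ)} (hc : ∀ᵐ p ∂mu, 0 ≤ Real.exp (-p.1) - 1)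
    {u a : ℝ} (ha : a ∈ Lstar mu) (hu : u ∈ Ustar mu) (hua : u < a) :
    Lstar mu = Set.univ := by
  refine eq_univ_of_forall fun v ↦ mem_Lstar_iff_ae.2 ?_
  filter_upwards [hc, mem_Lstar_iff_ae.1 ha, mem_Ustar_iff_ae.1 hu] with p hp hap hup
  have hzero : Real.exp (-p.1) - 1 = 0 := by nlinarith
  simpa [hzero] using hap

theorem ustar_of_lstar_Iic (mu : Measure (ℝ × ℝ)) (a : ℝ)
    (hL : Lstar mu = Set.Iic a) :
    Ustar mu = ∅ ∨ ∃ b : ℝ, a ≤ b ∧ Ustar mu = Set.Ici b := by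
  have hc := ae_exp_neg_sub_one_nonneg_of_Iic_subset_Lstar hL.ge
  have hlb : a ∈ lowerBounds (Ustar mu) := fun u hu ↦ by
    by_contra! hua
    have huniv := Lstar_eq_univ_of_lt hc (hL.ge self_mem_Iic) hu hua
    exact not_bddAbove_univ (huniv ▸ hL ▸ bddAbove_Iic)
  refine (Ustar mu).eq_empty_or_nonempty.imp_right fun hne ↦
    ⟨sInf (Ustar mu), le_csInf hne hlb, ?_⟩
  exact Subset.antisymm (fun u hu ↦ csInf_le ⟨a, hlb⟩ hu) fun u hu ↦
    mem_Ustar_of_le hc ((isClosed_Ustar mu).csInf_mem hne ⟨a, hlb⟩) hu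

end
end

section
/- Suppose Π(A₂∖A₁) > 0. Then for every real u ≥ 0, Π(A₂(u)) > 0 if and only if u < θ₂ (in the extended reals); in particular Π(A₂(θ₂)) = 0 whenever θ₂ is finite. Similarly, suppose Π(A₄∖A₁) > 0; then for every real u ≥ 0, Π(A₄(u)) > 0 if and only if θ₄ < u, and in particular Π(A₄(θ₄)) = 0 whenever θ₄ is finite. (Intermediate characterization, used in identifying the endpoints of the interval L*, that the supremum θ₂ and infimum θ₄ are attained as members of the zero-measure region.) -/
open MeasureTheory Set Filter

noncomputable section

/-- Lower semicontinuity in the slope: a region of positive measure below the curve keeps positive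
measure along some term of any sequence of slopes converging to the given one. -/
lemma exists_measure_inter_Cneg_pos {mu : Measure (ℝ × ℝ)} {S : Set (ℝ × ℝ)} {u : ℝ} {w : ℕ → ℝ}
    (hw : Tendsto w atTop (nhds u)) (h : 0 < mu (S ∩ Cneg u)) :
    ∃ n, 0 < mu (S ∩ Cneg (w n)) := by
  by_contra! hn
  refine h.ne' (measure_mono_null ?_ (measure_iUnion_null fun n => le_antisymm (hn n) zero_le))
  rintro p ⟨hpS, hp⟩
  have ht : Tendsto (fun n => p.2 - w n * (Real.exp (-p.1) - 1)) atTop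
      (nhds (p.2 - u * (Real.exp (-p.1) - 1))) :=
    tendsto_const_nhds.sub (hw.mul tendsto_const_nhds)
  obtain ⟨n, hpn⟩ := (ht.eventually (gt_mem_nhds hp)).exists
  exact mem_iUnion.2 ⟨n, hpS, hpn⟩

lemma A2_inter_Cneg_anti {u v : ℝ} (h : u ≤ v) : A2 ∩ Cneg v ⊆ A2 ∩ Cneg u := by
  rintro p ⟨hpA, hp⟩
  refine ⟨hpA, ?_⟩
  have he : Real.exp (-p.1) ≤ 1 := Real.exp_le_one_iff.2 (neg_nonpos.2 hpA.1)
  simp only [Cneg, mem_ofPred_eq] at hp ⊢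
  nlinarith

lemma A4_inter_Cneg_mono {u v : ℝ} (h : u ≤ v) : A4 ∩ Cneg u ⊆ A4 ∩ Cneg v := by
  rintro p ⟨hpA, hp⟩
  refine ⟨hpA, ?_⟩
  have he : 1 ≤ Real.exp (-p.1) := Real.one_le_exp (neg_nonneg.2 hpA.1)
  simp only [Cneg, mem_ofPred_eq] at hp ⊢
  nlinarith

lemma A4_inter_Cneg_zero : A4 ∩ Cneg 0 = ∅ := by
  ext p
  simp only [A4, Cneg, mem_inter_iff, mem_ofPred_eq, zero_mul, sub_zero, mem_empty_iff_false,
    iff_false, not_and, not_lt]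
  exact fun h => h.2

lemma A2_diff_A1_subset : A2 \ A1 ⊆ A2 ∩ Cneg 0 := by
  rintro p ⟨hp2, hp1⟩
  refine ⟨hp2, ?_⟩
  simp only [Cneg, mem_ofPred_eq, zero_mul, sub_zero]
  exact not_le.1 fun hy => hp1 ⟨hp2.1, hy⟩

lemma pos_of_measure_A4_inter_Cneg_pos {mu : Measure (ℝ × ℝ)} {u : ℝ}
    (h : 0 < mu (A4 ∩ Cneg u)) : 0 < u := by
  by_contra! hu
  have hsub := A4_inter_Cneg_mono hu
  rw [A4_inter_Cneg_zero] at hsub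
  exact h.ne' (measure_mono_null hsub measure_empty)

lemma measure_A2_inter_Cneg_pos_iff {mu : Measure (ℝ × ℝ)} (h : 0 < mu (A2 \ A1)) {u : ℝ}
    (hu : 0 ≤ u) : 0 < mu (A2 ∩ Cneg u) ↔ (u : EReal) < theta2 mu := by
  rw [theta2, if_pos h, lt_sSup_iff]
  constructor
  · intro hpos
    have hw : Tendsto (fun n : ℕ => u + 1 / ((n : ℝ) + 1)) atTop (nhds u) := by
      simpa using tendsto_const_nhds.add (tendsto_one_div_add_atTop_nhds_zero_nat (𝕜 := ℝ))
    obtain ⟨n, hn⟩ := exists_measure_inter_Cneg_pos hw hpos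
    have hn0 : (0 : ℝ) < 1 / ((n : ℝ) + 1) := Nat.one_div_pos_of_nat
    exact ⟨_, ⟨_, ⟨by linarith, hn⟩, rfl⟩, EReal.coe_lt_coe_iff.2 (by linarith)⟩
  · rintro ⟨_, ⟨v, ⟨-, hv⟩, rfl⟩, huv⟩
    exact hv.trans_le (measure_mono (A2_inter_Cneg_anti (EReal.coe_lt_coe_iff.1 huv).le))

lemma measure_A4_inter_Cneg_pos_iff {mu : Measure (ℝ × ℝ)} (h : 0 < mu (A4 \ A1)) {u : ℝ} :
    0 < mu (A4 ∩ Cneg u) ↔ theta4 mu < (u : EReal) := by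
  rw [theta4, if_pos h, sInf_lt_iff]
  constructor
  · intro hpos
    have hw : Tendsto (fun n : ℕ => u - 1 / ((n : ℝ) + 1)) atTop (nhds u) := by
      simpa using tendsto_const_nhds.sub (tendsto_one_div_add_atTop_nhds_zero_nat (𝕜 := ℝ))
    obtain ⟨n, hn⟩ := exists_measure_inter_Cneg_pos hw hpos
    have hn0 : (0 : ℝ) < 1 / ((n : ℝ) + 1) := Nat.one_div_pos_of_nat
    exact ⟨_, ⟨_, ⟨(pos_of_measure_A4_inter_Cneg_pos hn).le, hn⟩, rfl⟩,
      EReal.coe_lt_coe_iff.2 (by linarith)⟩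
  · rintro ⟨_, ⟨v, ⟨-, hv⟩, rfl⟩, hvu⟩
    exact hv.trans_le (measure_mono (A4_inter_Cneg_mono (EReal.coe_lt_coe_iff.1 hvu).le))

lemma theta2_nonneg {mu : Measure (ℝ × ℝ)} (h : 0 < mu (A2 \ A1)) : 0 ≤ theta2 mu := by
  have := (measure_A2_inter_Cneg_pos_iff h le_rfl).1 (h.trans_le (measure_mono A2_diff_A1_subset))
  exact this.le

theorem theta2_theta4_attained (mu : Measure (ℝ × ℝ)) :
    (0 < mu (A2 \ A1) →
      (∀ u : ℝ, 0 ≤ u → (0 < mu (A2 ∩ Cneg u) ↔ (u : EReal) < theta2 mu)) ∧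
      (∀ u : ℝ, theta2 mu = (u : EReal) → mu (A2 ∩ Cneg u) = 0)) ∧
    (0 < mu (A4 \ A1) →
      (∀ u : ℝ, 0 ≤ u → (0 < mu (A4 ∩ Cneg u) ↔ theta4 mu < (u : EReal))) ∧
      (∀ u : ℝ, theta4 mu = (u : EReal) → mu (A4 ∩ Cneg u) = 0)) := by
  refine ⟨fun h => ⟨fun u hu => measure_A2_inter_Cneg_pos_iff h hu, fun u hu => ?_⟩,
    fun h => ⟨fun u _ => measure_A4_inter_Cneg_pos_iff h, fun u hu => ?_⟩⟩
  · have hu0 : 0 ≤ u := EReal.coe_nonneg.1 (hu ▸ theta2_nonneg h)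
    by_contra hne
    exact ((measure_A2_inter_Cneg_pos_iff h hu0).1 (pos_iff_ne_zero.2 hne)).ne hu.symm
  · by_contra hne
    exact ((measure_A4_inter_Cneg_pos_iff h).1 (pos_iff_ne_zero.2 hne)).ne hu

end
end
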